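/- Let R₁, R₂ be Boolean random variables, Z₁ : Ω → χ₁, Z₂ : Ω → χ₂, W : Ω → 𝒲 random variables with finite value types, and suppose the joint distribution of (R₁, R₂, Z₁, Z₂, W) assigns positive probability to every value combination. Assume (a) R₁ ⊥ Z₁ | (R₂, Z₂, W) and (b) R₂ ⊥ Z₂ | (R₁, Z₁, W). Then the conditional odds ratio of R₁ and R₂ does not depend on the values of Z₁ and Z₂: for all r₁, r₂, all w, and all z₁, z₁' ∈ χ₁, z₂, z₂' ∈ χ₂, OR(r₁, r₂ | {Z₁ = z₁, Z₂ = z₂, W = w}) = OR(r₁, r₂ | {Z₁ = z₁', Z₂ = z₂', W = w}). (This is the key step in the proofs of Theorems 1 and 4: pairwise odds ratio terms are identified because OR(R_k, R_i | ·) is not a function of the variables censored by R_k or R_i.) -/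

import Mathlib

open scoped BigOperators

/-- Probability of the event `A` under the (finitely supported) law `P`. -/
noncomputable def Pr {Ω : Type*} [Fintype Ω] (P : Ω → ℝ) (A : Set Ω) : ℝ :=
  ∑ ω, A.indicator P ω

/-- Conditional probability `P(A | B) = P(A ∩ B) / P(B)`. -/
noncomputable def cPr {Ω : Type*} [Fintype Ω] (P : Ω → ℝ) (A B : Set Ω) : ℝ :=
  Pr P (A ∩ B) / Pr P B

/-- The conditional odds ratio
`OR(r₁, r₂ | E) = [P(R₁=r₁ | R₂=r₂, E) / P(R₁=1 | R₂=r₂, E)]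
  · [P(R₁=1 | R₂=1, E) / P(R₁=r₁ | R₂=1, E)]`. -/
noncomputable def ORcond {Ω : Type*} [Fintype Ω] (P : Ω → ℝ) (R₁ R₂ : Ω → Bool)
    (E : Set Ω) (r₁ r₂ : Bool) : ℝ :=
  (cPr P {ω | R₁ ω = r₁} ({ω | R₂ ω = r₂} ∩ E)
      / cPr P {ω | R₁ ω = true} ({ω | R₂ ω = r₂} ∩ E))
    * (cPr P {ω | R₁ ω = true} ({ω | R₂ ω = true} ∩ E)
      / cPr P {ω | R₁ ω = r₁} ({ω | R₂ ω = true} ∩ E))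

theorem Pr_mono {Ω : Type*} [Fintype Ω] {P : Ω → ℝ} (hP : ∀ ω, 0 ≤ P ω) {A B : Set Ω}
    (h : A ⊆ B) : Pr P A ≤ Pr P B :=
  Finset.sum_le_sum fun ω _ => Set.indicator_le_indicator_of_subset h hP ω

theorem Pr_nonneg {Ω : Type*} [Fintype Ω] {P : Ω → ℝ} (hP : ∀ ω, 0 ≤ P ω) (A : Set Ω) :
    0 ≤ Pr P A :=
  Finset.sum_nonneg fun ω _ => Set.indicator_nonneg (fun ω _ => hP ω) ω

theorem cPr_mul_Pr {Ω : Type*} [Fintype Ω] {P : Ω → ℝ} (hP : ∀ ω, 0 ≤ P ω) (A B : Set Ω) :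
    cPr P A B * Pr P B = Pr P (A ∩ B) :=
  div_mul_cancel_of_imp fun h =>
    le_antisymm (h ▸ Pr_mono hP Set.inter_subset_right) (Pr_nonneg hP _)

/-- A family of events that factorizes conditionally on `C` has equal cross products. -/
theorem Pr_inter_cross_mul {Ω α β : Type*} [Fintype Ω] {P : Ω → ℝ} (hP : ∀ ω, 0 ≤ P ω)
    {X : Ω → α} {Y : Ω → β} {C : Set Ω}
    (h : ∀ x y, cPr P {ω | X ω = x ∧ Y ω = y} C = cPr P {ω | X ω = x} C * cPr P {ω | Y ω = y} C)
    (x x' : α) (y y' : β) :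
    Pr P ({ω | X ω = x ∧ Y ω = y} ∩ C) * Pr P ({ω | X ω = x' ∧ Y ω = y'} ∩ C)
      = Pr P ({ω | X ω = x' ∧ Y ω = y} ∩ C) * Pr P ({ω | X ω = x ∧ Y ω = y'} ∩ C) := by
  simp only [← cPr_mul_Pr hP _ C, h]
  ring

/-- The conditional odds ratio as a ratio of joint probabilities. -/
theorem ORcond_eq {Ω : Type*} [Fintype Ω] {P : Ω → ℝ} (hP : ∀ ω, 0 ≤ P ω) (R₁ R₂ : Ω → Bool)
    (E : Set Ω) (hpos : ∀ a b, 0 < Pr P ({ω | R₁ ω = a} ∩ ({ω | R₂ ω = b} ∩ E)))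
    (r₁ r₂ : Bool) :
    ORcond P R₁ R₂ E r₁ r₂
      = Pr P ({ω | R₁ ω = r₁} ∩ ({ω | R₂ ω = r₂} ∩ E))
          / Pr P ({ω | R₁ ω = true} ∩ ({ω | R₂ ω = r₂} ∩ E))
        * (Pr P ({ω | R₁ ω = true} ∩ ({ω | R₂ ω = true} ∩ E))
          / Pr P ({ω | R₁ ω = r₁} ∩ ({ω | R₂ ω = true} ∩ E))) := by
  have hne (b : Bool) : Pr P ({ω | R₂ ω = b} ∩ E) ≠ 0 :=
    ((hpos true b).trans_le (Pr_mono hP Set.inter_subset_right)).ne'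
  simp only [ORcond, cPr, div_div_div_cancel_right₀ (hne _)]

/-- If `R₁ ⊥ Z₁ | (R₂, Z₂, W)` and `R₂ ⊥ Z₂ | (R₁, Z₁, W)`, then the conditional odds
ratio of `R₁` and `R₂` given `(Z₁, Z₂, W)` does not depend on the values of `Z₁` and `Z₂`
(the key step in the proofs of Theorems 1 and 4). -/
theorem stmt_6 {Ω χ₁ χ₂ 𝒲 : Type*} [Fintype Ω] [Fintype χ₁] [Fintype χ₂] [Fintype 𝒲]
    [Nonempty χ₁] [Nonempty χ₂] [Nonempty 𝒲]
    (P : Ω → ℝ) (hP : ∀ ω, 0 ≤ P ω) (hPsum : ∑ ω, P ω = 1)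
    (R₁ R₂ : Ω → Bool) (Z₁ : Ω → χ₁) (Z₂ : Ω → χ₂) (W : Ω → 𝒲)
    (hpos : ∀ (a b : Bool) (z₁ : χ₁) (z₂ : χ₂) (w : 𝒲),
      0 < Pr P {ω | R₁ ω = a ∧ R₂ ω = b ∧ Z₁ ω = z₁ ∧ Z₂ ω = z₂ ∧ W ω = w})
    (hCI₁ : ∀ (a : Bool) (z₁ : χ₁) (b : Bool) (z₂ : χ₂) (w : 𝒲),
      cPr P {ω | R₁ ω = a ∧ Z₁ ω = z₁} {ω | R₂ ω = b ∧ Z₂ ω = z₂ ∧ W ω = w}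
        = cPr P {ω | R₁ ω = a} {ω | R₂ ω = b ∧ Z₂ ω = z₂ ∧ W ω = w}
          * cPr P {ω | Z₁ ω = z₁} {ω | R₂ ω = b ∧ Z₂ ω = z₂ ∧ W ω = w})
    (hCI₂ : ∀ (b : Bool) (z₂ : χ₂) (a : Bool) (z₁ : χ₁) (w : 𝒲),
      cPr P {ω | R₂ ω = b ∧ Z₂ ω = z₂} {ω | R₁ ω = a ∧ Z₁ ω = z₁ ∧ W ω = w}
        = cPr P {ω | R₂ ω = b} {ω | R₁ ω = a ∧ Z₁ ω = z₁ ∧ W ω = w}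
          * cPr P {ω | Z₂ ω = z₂} {ω | R₁ ω = a ∧ Z₁ ω = z₁ ∧ W ω = w}) :
    ∀ (r₁ r₂ : Bool) (w : 𝒲) (z₁ z₁' : χ₁) (z₂ z₂' : χ₂),
      ORcond P R₁ R₂ {ω | Z₁ ω = z₁ ∧ Z₂ ω = z₂ ∧ W ω = w} r₁ r₂
        = ORcond P R₁ R₂ {ω | Z₁ ω = z₁' ∧ Z₂ ω = z₂' ∧ W ω = w} r₁ r₂ := by
  intro r₁ r₂ w z₁ z₁' z₂ z₂'
  let q (a b : Bool) (z₁ : χ₁) (z₂ : χ₂) : ℝ :=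
    Pr P {ω | R₁ ω = a ∧ R₂ ω = b ∧ Z₁ ω = z₁ ∧ Z₂ ω = z₂ ∧ W ω = w}
  have hq (a b z₁ z₂) : 0 < q a b z₁ z₂ := hpos a b z₁ z₂ w
  have cross₁ (a a' b z z' y) : q a b z y * q a' b z' y = q a' b z y * q a b z' y := by
    have hset (a z) : {ω | R₁ ω = a ∧ Z₁ ω = z} ∩ {ω | R₂ ω = b ∧ Z₂ ω = y ∧ W ω = w}
        = {ω | R₁ ω = a ∧ R₂ ω = b ∧ Z₁ ω = z ∧ Z₂ ω = y ∧ W ω = w} := by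
      ext ω; simp only [Set.mem_inter_iff, Set.mem_ofPred_eq]; tauto
    simpa only [hset] using Pr_inter_cross_mul hP (fun a z => hCI₁ a z b y w) a a' z z'
  have cross₂ (b b' a y y' z) : q a b z y * q a b' z y' = q a b' z y * q a b z y' := by
    have hset (b y) : {ω | R₂ ω = b ∧ Z₂ ω = y} ∩ {ω | R₁ ω = a ∧ Z₁ ω = z ∧ W ω = w}
        = {ω | R₁ ω = a ∧ R₂ ω = b ∧ Z₁ ω = z ∧ Z₂ ω = y ∧ W ω = w} := by
      ext ω; simp only [Set.mem_inter_iff, Set.mem_ofPred_eq]; tauto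
    simpa only [hset] using Pr_inter_cross_mul hP (fun b y => hCI₂ b y a z w) b b' y y'
  have ratio₁ (a a' b z z' y) : q a b z y / q a' b z y = q a b z' y / q a' b z' y := by
    rw [div_eq_div_iff (hq ..).ne' (hq ..).ne', cross₁, mul_comm]
  have ratio₂ (b b' a y y' z) : q a b z y / q a b' z y = q a b z y' / q a b' z y' := by
    rw [div_eq_div_iff (hq ..).ne' (hq ..).ne', cross₂, mul_comm]
  have hOR (z y) : ORcond P R₁ R₂ {ω | Z₁ ω = z ∧ Z₂ ω = y ∧ W ω = w} r₁ r₂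
      = q r₁ r₂ z y / q true r₂ z y * (q true true z y / q r₁ true z y) :=
    ORcond_eq hP R₁ R₂ _ (fun a b => hpos a b z y w) r₁ r₂
  have swap (z y) : q r₁ r₂ z y / q true r₂ z y * (q true true z y / q r₁ true z y)
      = q r₁ r₂ z y / q r₁ true z y * (q true true z y / q true r₂ z y) := by
    rw [div_mul_div_comm, div_mul_div_comm, mul_comm (q true r₂ z y)]
  rw [hOR, hOR, ratio₁ r₁ true r₂ z₁ z₁', ratio₁ true r₁ true z₁ z₁', swap, swap,
    ratio₂ r₂ true r₁ z₂ z₂', ratio₂ true r₂ true z₂ z₂']
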